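/- arXiv:1106.4195 — 4 statements merged into one kernel-verified Lean document; each statement's English description precedes it below -/
import Mathlib

section
/- For every real u with u < log 2 and u ≠ 0, the series Σ_{k=1}^∞ ((-1)^{k+1}/(k(k+1)))·(e^u − 1)^k converges and 1 + Σ_{k=1}^∞ ((-1)^{k+1}/(k(k+1)))·(e^u − 1)^k = u/(1 − e^{−u}). -/
/-- The power series expansion `(1 + t) log (1 + t) / t - 1 = Σ_{k ≥ 1} (-1)^{k+1} t^k / (k(k+1))`
for `0 < |t| < 1`. -/
theorem hasSum_one_add_mul_log_div_sub_one {t : ℝ} (ht : |t| < 1) (ht0 : t ≠ 0) :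
    HasSum (fun k : ℕ =>
      (-1 : ℝ) ^ ((k + 1) + 1) / (((k : ℝ) + 1) * (((k : ℝ) + 1) + 1)) * t ^ (k + 1))
      ((1 + t) * Real.log (1 + t) / t - 1) := by
  have hlog := Real.hasSum_pow_div_log_of_abs_lt_one (x := -t) (by rwa [abs_neg])
  have hshift := ((hasSum_nat_add_iff' 1).mpr hlog).mul_left (-t)⁻¹
  convert! hshift.sub hlog using 1
  · funext k
    have hk : (k : ℝ) + 1 ≠ 0 := by positivity
    have hk' : (k : ℝ) + 1 + 1 ≠ 0 := by positivity
    push_cast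
    rw [neg_pow t (k + 1), neg_pow t (k + 1 + 1)]
    field_simp
    ring
  · simp only [sub_neg_eq_add, Finset.sum_range_one]
    field_simp
    push_cast
    ring

/-- For every real `u` with `u < log 2` and `u ≠ 0`, the series
`Σ_{k=1}^∞ ((-1)^{k+1}/(k(k+1)))·(e^u − 1)^k` converges and
`1 + Σ_{k=1}^∞ ((-1)^{k+1}/(k(k+1)))·(e^u − 1)^k = u/(1 − e^{−u})`. -/
theorem ch_psi_equals_todd (u : ℝ) (hu : u < Real.log 2) (hu0 : u ≠ 0) :
    Summable (fun k : ℕ =>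
      (-1 : ℝ) ^ ((k + 1) + 1) / (((k : ℝ) + 1) * (((k : ℝ) + 1) + 1)) *
        (Real.exp u - 1) ^ (k + 1)) ∧
    1 + ∑' k : ℕ,
        (-1 : ℝ) ^ ((k + 1) + 1) / (((k : ℝ) + 1) * (((k : ℝ) + 1) + 1)) *
          (Real.exp u - 1) ^ (k + 1) =
      u / (1 - Real.exp (-u)) := by
  have hexp : Real.exp u < 2 := (Real.lt_log_iff_exp_lt two_pos).mp hu
  have ht0 : Real.exp u - 1 ≠ 0 := by simpa [sub_eq_zero] using hu0
  have ht : |Real.exp u - 1| < 1 :=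
    abs_lt.mpr ⟨by linarith [Real.exp_pos u], by linarith⟩
  have h := hasSum_one_add_mul_log_div_sub_one ht ht0
  refine ⟨h.summable, ?_⟩
  have hden : 1 - Real.exp (-u) = (Real.exp u - 1) / Real.exp u := by
    rw [Real.exp_neg]
    field_simp
  rw [h.tsum_eq, add_sub_cancel, add_sub_cancel, Real.log_exp, hden, div_div_eq_mul_div, mul_comm]
end

section
/- Fix n ∈ ℕ and work in the polynomial ring MvPolynomial (Fin n) ℚ with variables X_0, …, X_{n−1}. Let Q = Π_{j=0}^{n−1} (1 − X_j/2 + X_j²/3 − X_j³/4) and let e_1, e_2, e_3 denote the elementary symmetric polynomials in X_0, …, X_{n−1}. Then the homogeneous component of Q of degree 0 equals 1, the homogeneous component of degree 1 equals −e_1/2, the homogeneous component of degree 2 equals (4e_1² − 5e_2)/12, and the homogeneous component of degree 3 equals (−6e_1³ + 14e_1e_2 − 9e_3)/24. -/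
open MvPolynomial

/-- Pascal-type recursion for elementary symmetric functions of a multiset. -/
lemma Multiset.esymm_cons_succ {R : Type*} [CommSemiring R] (a : R) (s : Multiset R) (k : ℕ) :
    (a ::ₘ s).esymm (k + 1) = s.esymm (k + 1) + a * s.esymm k := by
  simp [Multiset.esymm, Multiset.powersetCard_cons, Multiset.sum_map_mul_left]

namespace MvPolynomial

variable {σ R : Type*} [CommSemiring R]

lemma homogeneousComponent_mul_of_isHomogeneous_right {g : MvPolynomial σ R} {m : ℕ}
    (hg : g.IsHomogeneous m) (f : MvPolynomial σ R) (k : ℕ) :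
    homogeneousComponent k (f * g) = if m ≤ k then homogeneousComponent (k - m) f * g else 0 := by
  let _ : GradedAlgebra (homogeneousSubmodule σ R) := gradedAlgebra
  have hg' : g ∈ homogeneousSubmodule σ R m := hg
  have key := DirectSum.coe_decompose_mul_of_right_mem (homogeneousSubmodule σ R) k (a := f) hg'
  simp only [← decomposition.decompose'_apply]
  exact key

lemma homogeneousComponent_mul_X_pow (f : MvPolynomial σ R) (j : σ) (m k : ℕ) :
    homogeneousComponent k (f * X j ^ m) =
      if m ≤ k then homogeneousComponent (k - m) f * X j ^ m else 0 :=
  homogeneousComponent_mul_of_isHomogeneous_right (isHomogeneous_X_pow j m) f k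

end MvPolynomial

lemma homogeneousComponent_prod_log_eq_esymm {σ : Type*} (s : Finset σ) :
    let Q : MvPolynomial σ ℚ :=
      ∏ j ∈ s, (1 - C (1 / 2 : ℚ) * X j + C (1 / 3 : ℚ) * X j ^ 2 - C (1 / 4 : ℚ) * X j ^ 3)
    let e : ℕ → MvPolynomial σ ℚ := (s.val.map X).esymm
    homogeneousComponent 0 Q = 1 ∧
    homogeneousComponent 1 Q = C (-(1 / 2) : ℚ) * e 1 ∧
    homogeneousComponent 2 Q = C (1 / 12 : ℚ) * (4 * e 1 ^ 2 - 5 * e 2) ∧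
    homogeneousComponent 3 Q =
      C (1 / 24 : ℚ) * (-6 * e 1 ^ 3 + 14 * e 1 * e 2 - 9 * e 3) := by
  induction s using Finset.cons_induction with
  | empty =>
    have h (k : ℕ) : homogeneousComponent k (1 : MvPolynomial σ ℚ) = if k = 0 then 1 else 0 :=
      homogeneousComponent_of_mem (isHomogeneous_one σ ℚ)
    simp [h, Multiset.esymm, Multiset.powersetCard_zero_right]
  | cons a s ha ih =>
    obtain ⟨h0, h1, h2, h3⟩ := ih
    have expand (f : MvPolynomial σ ℚ) :
        (1 - C (1 / 2 : ℚ) * X a + C (1 / 3 : ℚ) * X a ^ 2 - C (1 / 4 : ℚ) * X a ^ 3) * f =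
          f - C (1 / 2 : ℚ) * (f * X a ^ 1) + C (1 / 3 : ℚ) * (f * X a ^ 2)
            - C (1 / 4 : ℚ) * (f * X a ^ 3) := by ring
    have e0 (t : Multiset (MvPolynomial σ ℚ)) : t.esymm 0 = 1 := by simp [Multiset.esymm]
    -- Every scalar is an integer multiple of `1 / 24`, which leaves a polynomial identity.
    have c12 : C (1 / 2 : ℚ) = 12 * (C (1 / 24) : MvPolynomial σ ℚ) := by
      rw [← map_ofNat C, ← map_mul]; norm_num
    have c12' : C (-(1 / 2) : ℚ) = -12 * (C (1 / 24) : MvPolynomial σ ℚ) := by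
      rw [← map_ofNat C, ← map_neg, ← map_mul]; norm_num
    have c8 : C (1 / 3 : ℚ) = 8 * (C (1 / 24) : MvPolynomial σ ℚ) := by
      rw [← map_ofNat C, ← map_mul]; norm_num
    have c6 : C (1 / 4 : ℚ) = 6 * (C (1 / 24) : MvPolynomial σ ℚ) := by
      rw [← map_ofNat C, ← map_mul]; norm_num
    have c2 : C (1 / 12 : ℚ) = 2 * (C (1 / 24) : MvPolynomial σ ℚ) := by
      rw [← map_ofNat C, ← map_mul]; norm_num
    have c1 : 24 * (C (1 / 24) : MvPolynomial σ ℚ) = 1 := by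
      rw [← map_ofNat C, ← map_mul]; norm_num
    simp only [Finset.prod_cons, expand, map_sub, map_add, homogeneousComponent_C_mul,
      homogeneousComponent_mul_X_pow, Finset.cons_val, Multiset.map_cons]
    simp only [Multiset.esymm_cons_succ _ _ 0, Multiset.esymm_cons_succ _ _ 1,
      Multiset.esymm_cons_succ _ _ 2, e0, zero_add]
    norm_num only [h0, h1, h2, h3]
    generalize (C (1 / 24 : ℚ) : MvPolynomial σ ℚ) = c at *
    simp only [c12, c12', c8, c6, c2]
    refine ⟨?_, ?_, ?_, ?_⟩ <;> grind

/-- In `MvPolynomial (Fin n) ℚ`, let `Q = Π_j (1 − X_j/2 + X_j²/3 − X_j³/4)`. Its homogeneous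
components of degrees 0,1,2,3 are `1`, `−e₁/2`, `(4e₁² − 5e₂)/12`, `(−6e₁³ + 14e₁e₂ − 9e₃)/24`. -/
theorem homogeneous_components_of_log_product (n : ℕ) :
    let Q : MvPolynomial (Fin n) ℚ :=
      ∏ j : Fin n,
        (1 - C (1 / 2 : ℚ) * X j + C (1 / 3 : ℚ) * X j ^ 2 - C (1 / 4 : ℚ) * X j ^ 3)
    homogeneousComponent 0 Q = 1 ∧
    homogeneousComponent 1 Q = C (-(1 / 2) : ℚ) * esymm (Fin n) ℚ 1 ∧
    homogeneousComponent 2 Q =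
      C (1 / 12 : ℚ) * (4 * esymm (Fin n) ℚ 1 ^ 2 - 5 * esymm (Fin n) ℚ 2) ∧
    homogeneousComponent 3 Q =
      C (1 / 24 : ℚ) *
        (-6 * esymm (Fin n) ℚ 1 ^ 3 + 14 * esymm (Fin n) ℚ 1 * esymm (Fin n) ℚ 2
          - 9 * esymm (Fin n) ℚ 3) := by
  simpa only [esymm_eq_multiset_esymm] using
    homogeneousComponent_prod_log_eq_esymm (Finset.univ : Finset (Fin n))
end

section
/- Let ξ, η ∈ ℝ³ be unit vectors and let v ∈ ℂ² be a nonzero vector such that c(ξ)·v = −v and c(η)·v = v. Then ⟨ξ, η⟩ = −1 (equivalently, η = −ξ). In particular, if ⟨ξ, η⟩ > −1 then the only v ∈ ℂ² with c(ξ)·v = −v and c(η)·v = v is v = 0. -/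
open Matrix

/-- The Pauli matrix `c₁ = [[0,1],[1,0]]`. -/
def pauli1 : Matrix (Fin 2) (Fin 2) ℂ := !![0, 1; 1, 0]

/-- The Pauli matrix `c₂ = [[0,−i],[i,0]]`. -/
def pauli2 : Matrix (Fin 2) (Fin 2) ℂ := !![0, -Complex.I; Complex.I, 0]

/-- The Pauli matrix `c₃ = [[1,0],[0,−1]]`. -/
def pauli3 : Matrix (Fin 2) (Fin 2) ℂ := !![1, 0; 0, -1]

/-- For `ξ ∈ ℝ³`, the Clifford symbol `c(ξ) = ξ₁·c₁ + ξ₂·c₂ + ξ₃·c₃`. -/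
noncomputable def cliff (ξ : Fin 3 → ℝ) : Matrix (Fin 2) (Fin 2) ℂ :=
  (ξ 0 : ℂ) • pauli1 + (ξ 1 : ℂ) • pauli2 + (ξ 2 : ℂ) • pauli3

/-- The Clifford relation `c(ξ)c(η) + c(η)c(ξ) = 2⟨ξ,η⟩·I₂`. -/
theorem cliff_mul_add_cliff_mul (ξ η : Fin 3 → ℝ) :
    cliff ξ * cliff η + cliff η * cliff ξ =
      (2 * (ξ 0 * η 0 + ξ 1 * η 1 + ξ 2 * η 2 : ℝ) : ℂ) • (1 : Matrix (Fin 2) (Fin 2) ℂ) := by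
  ext i j
  fin_cases i <;> fin_cases j <;>
    simp [cliff, pauli1, pauli2, pauli3] <;>
    first
    | ring1
    | linear_combination (-2 * ξ 1 * η 1 : ℂ) * Complex.I_sq

theorem inner_eq_neg_one_of_cliff_eigenvector {ξ η : Fin 3 → ℝ} {v : Fin 2 → ℂ} (hv : v ≠ 0)
    (h₁ : (cliff ξ).mulVec v = -v) (h₂ : (cliff η).mulVec v = v) :
    ξ 0 * η 0 + ξ 1 * η 1 + ξ 2 * η 2 = -1 := by
  have h := congrArg (fun A => A.mulVec v) (cliff_mul_add_cliff_mul ξ η)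
  simp only [Matrix.add_mulVec, ← Matrix.mulVec_mulVec, h₁, h₂, Matrix.mulVec_neg,
    Matrix.smul_mulVec, Matrix.one_mulVec] at h
  obtain ⟨i, hi⟩ := Function.ne_iff.mp hv
  have hc : ((ξ 0 * η 0 + ξ 1 * η 1 + ξ 2 * η 2 : ℝ) : ℂ) = ((-1 : ℝ) : ℂ) := by
    have := congrFun h i
    simp only [Pi.add_apply, Pi.neg_apply, Pi.smul_apply, smul_eq_mul] at this
    refine mul_right_cancel₀ hi ?_
    push_cast at this ⊢
    linear_combination -this / 2
  exact Complex.ofReal_injective hc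

/-- If `ξ, η ∈ ℝ³` are unit vectors and `v ∈ ℂ²` is a nonzero vector with `c(ξ)·v = −v` and
`c(η)·v = v`, then `⟨ξ, η⟩ = −1` (equivalently `η = −ξ`). In particular, if `⟨ξ, η⟩ > −1`
then the only such `v` is `v = 0`. -/
theorem ellipticity_eigenvector_obstruction (ξ η : Fin 3 → ℝ)
    (hξ : ξ 0 ^ 2 + ξ 1 ^ 2 + ξ 2 ^ 2 = 1) (hη : η 0 ^ 2 + η 1 ^ 2 + η 2 ^ 2 = 1) :
    (∀ v : Fin 2 → ℂ, v ≠ 0 → (cliff ξ).mulVec v = -v → (cliff η).mulVec v = v →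
      ξ 0 * η 0 + ξ 1 * η 1 + ξ 2 * η 2 = -1 ∧ η = -ξ) ∧
    (ξ 0 * η 0 + ξ 1 * η 1 + ξ 2 * η 2 > -1 →
      ∀ v : Fin 2 → ℂ, (cliff ξ).mulVec v = -v → (cliff η).mulVec v = v → v = 0) := by
  refine ⟨fun v hv h₁ h₂ => ?_, fun h v h₁ h₂ => ?_⟩
  · have h := inner_eq_neg_one_of_cliff_eigenvector hv h₁ h₂
    refine ⟨h, funext fun i => ?_⟩
    rw [Pi.neg_apply]
    fin_cases i <;> dsimp <;>
      nlinarith [sq_nonneg (ξ 0 + η 0), sq_nonneg (ξ 1 + η 1), sq_nonneg (ξ 2 + η 2)]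
  · by_contra hv
    exact h.ne' (inner_eq_neg_one_of_cliff_eigenvector hv h₁ h₂)
end

section
/- Let g be the real 3×3 matrix [[2,1,0],[1,1,0],[0,0,1]] (which is invertible), and for a unit vector ζ ∈ ℝ³ let p(ζ) = (I_2 + c(ζ))/2 ∈ Mat_2(ℂ). For every nonzero ξ ∈ ℝ³, set ζ = ξ/|ξ| and η = g⁻¹ξ/|g⁻¹ξ|. Then the linear map v ↦ p(ζ)·v, restricted to the range of p(η), is a bijection from the range of p(η) onto the range of p(ζ). -/
open Matrix

/-- For a unit vector `ζ ∈ ℝ³`, the projection `p(ζ) = (I₂ + c(ζ))/2`. -/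
noncomputable def pmat (ζ : Fin 3 → ℝ) : Matrix (Fin 2) (Fin 2) ℂ :=
  (2⁻¹ : ℂ) • (1 + cliff ζ)

/-- The Euclidean norm on `ℝ³`. -/
noncomputable def enorm3 (ξ : Fin 3 → ℝ) : ℝ := Real.sqrt (ξ 0 ^ 2 + ξ 1 ^ 2 + ξ 2 ^ 2)

/-- The cat-map matrix `g = [[2,1,0],[1,1,0],[0,0,1]]`. -/
def gmat : Matrix (Fin 3) (Fin 3) ℝ := !![2, 1, 0; 1, 1, 0; 0, 0, 1]

/-- The Clifford relation for the Pauli matrices. -/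
theorem cliff_mul_add_mul (a b : Fin 3 → ℝ) :
    cliff a * cliff b + cliff b * cliff a = (2 * (a ⬝ᵥ b : ℝ) : ℂ) • 1 := by
  ext i j
  fin_cases i <;> fin_cases j <;>
    simp [cliff, pauli1, pauli2, pauli3, dotProduct,
      Fin.sum_univ_three] <;>
    ring_nf <;> simp only [Complex.I_sq] <;> ring

theorem cliff_mul_self {a : Fin 3 → ℝ} (ha : a ⬝ᵥ a = 1) : cliff a * cliff a = 1 := by
  have h := cliff_mul_add_mul a a
  rw [ha, ← two_smul ℂ, Complex.ofReal_one, mul_one] at h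
  exact smul_right_injective _ (two_ne_zero' ℂ) h

/-- Compressing `p(b)` by the projection `p(a)` multiplies `p(a)` by `(1 + ⟨a, b⟩)/2`. -/
theorem pmat_mul_mul {a : Fin 3 → ℝ} (ha : a ⬝ᵥ a = 1) (b : Fin 3 → ℝ) :
    pmat a * pmat b * pmat a = ((1 + (a ⬝ᵥ b : ℝ)) / 2 : ℂ) • pmat a := by
  have hA := cliff_mul_self ha
  have hBA : cliff b * cliff a = (2 * (a ⬝ᵥ b : ℝ) : ℂ) • 1 - cliff a * cliff b :=
    eq_sub_of_add_eq' (cliff_mul_add_mul a b)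
  have hABA : cliff a * cliff b * cliff a = (2 * (a ⬝ᵥ b : ℝ) : ℂ) • cliff a - cliff b := by
    rw [mul_assoc, hBA, mul_sub, ← mul_assoc, hA, one_mul, mul_smul_comm, mul_one]
  simp only [pmat, smul_mul_assoc, mul_smul_comm, mul_add, add_mul, one_mul, mul_one, hA, hABA,
    hBA]
  module

theorem bijOn_pmat_mulVec {a b : Fin 3 → ℝ} (ha : a ⬝ᵥ a = 1) (hb : b ⬝ᵥ b = 1)
    (hab : a ⬝ᵥ b ≠ -1) :
    Set.BijOn (fun v : Fin 2 → ℂ => (pmat a).mulVec v)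
      (Set.range fun v : Fin 2 → ℂ => (pmat b).mulVec v)
      (Set.range fun v : Fin 2 → ℂ => (pmat a).mulVec v) := by
  have hk : ((1 + (a ⬝ᵥ b : ℝ)) / 2 : ℂ) ≠ 0 := by
    refine div_ne_zero (fun h => hab ?_) two_ne_zero
    have h' : 1 + a ⬝ᵥ b = 0 := by exact_mod_cast h
    linarith
  have hA := pmat_mul_mul ha b
  have hB := pmat_mul_mul hb a
  rw [dotProduct_comm b a] at hB
  generalize ((1 + (a ⬝ᵥ b : ℝ)) / 2 : ℂ) = k at hk hA hB
  refine ⟨fun v _ => ⟨v, rfl⟩, ?_, ?_⟩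
  · rintro _ ⟨v, rfl⟩ _ ⟨w, rfl⟩ h
    have h' := congrArg (pmat b).mulVec h
    simp only [mulVec_mulVec, ← mul_assoc, hB, smul_mulVec] at h'
    exact smul_right_injective _ hk h'
  · rintro _ ⟨v, rfl⟩
    refine ⟨_, ⟨k⁻¹ • (pmat a).mulVec v, rfl⟩, ?_⟩
    simp only [mulVec_smul, mulVec_mulVec, ← mul_assoc, hA, smul_mulVec]
    exact inv_smul_smul₀ hk _

theorem enorm3_eq_sqrt (x : Fin 3 → ℝ) : enorm3 x = √(x ⬝ᵥ x) := by
  simp [enorm3, dotProduct, Fin.sum_univ_three, pow_two]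

theorem dotProduct_self_pos {x : Fin 3 → ℝ} (hx : x ≠ 0) : 0 < x ⬝ᵥ x :=
  lt_of_le_of_ne (Finset.sum_nonneg fun i _ => mul_self_nonneg (x i))
    fun h => hx (dotProduct_self_eq_zero.1 h.symm)

theorem enorm3_pos {x : Fin 3 → ℝ} (hx : x ≠ 0) : 0 < enorm3 x := by
  rw [enorm3_eq_sqrt]
  exact Real.sqrt_pos.2 (dotProduct_self_pos hx)

theorem normalize_dotProduct_self {x : Fin 3 → ℝ} (hx : x ≠ 0) :
    ((enorm3 x)⁻¹ • x) ⬝ᵥ ((enorm3 x)⁻¹ • x) = 1 := by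
  have h := enorm3_pos hx
  have h2 : x ⬝ᵥ x = enorm3 x * enorm3 x := by
    rw [enorm3_eq_sqrt, Real.mul_self_sqrt (dotProduct_self_pos hx).le]
  rw [smul_dotProduct, dotProduct_smul, h2, smul_eq_mul, smul_eq_mul]
  field_simp

theorem isUnit_det_gmat : IsUnit gmat.det := by
  have h : gmat.det = 1 := by
    simp [gmat, det_fin_three]
    norm_num
  rw [h]
  exact isUnit_one

theorem gmat_mulVec_dotProduct_nonneg (x : Fin 3 → ℝ) : 0 ≤ gmat.mulVec x ⬝ᵥ x := by
  simp [gmat, mulVec, dotProduct, Fin.sum_univ_three]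
  nlinarith [sq_nonneg (x 0), sq_nonneg (x 0 + x 1), sq_nonneg (x 2)]

/-- The matrix `g = [[2,1,0],[1,1,0],[0,0,1]]` is invertible, and for every nonzero `ξ ∈ ℝ³`,
with `ζ = ξ/|ξ|` and `η = g⁻¹ξ/|g⁻¹ξ|`, the map `v ↦ p(ζ)·v` restricted to the range of
`p(η)` is a bijection from the range of `p(η)` onto the range of `p(ζ)`. -/
theorem symbol_isomorphism_cat_map (ξ : Fin 3 → ℝ) (hξ : ξ ≠ 0) :
    IsUnit gmat.det ∧
    (let ζ : Fin 3 → ℝ := (enorm3 ξ)⁻¹ • ξ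
     let η : Fin 3 → ℝ := (enorm3 (gmat⁻¹.mulVec ξ))⁻¹ • gmat⁻¹.mulVec ξ
     Set.BijOn (fun v : Fin 2 → ℂ => (pmat ζ).mulVec v)
       (Set.range fun v : Fin 2 → ℂ => (pmat η).mulVec v)
       (Set.range fun v : Fin 2 → ℂ => (pmat ζ).mulVec v)) := by
  refine ⟨isUnit_det_gmat, ?_⟩
  have hg : gmat.mulVec (gmat⁻¹.mulVec ξ) = ξ := by
    rw [mulVec_mulVec, mul_nonsing_inv _ isUnit_det_gmat, one_mulVec]
  have hμ : gmat⁻¹.mulVec ξ ≠ 0 := fun h => hξ (by rw [← hg, h, mulVec_zero])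
  have hpos : 0 ≤ ξ ⬝ᵥ gmat⁻¹.mulVec ξ := by
    simpa only [hg] using gmat_mulVec_dotProduct_nonneg (gmat⁻¹.mulVec ξ)
  refine bijOn_pmat_mulVec (normalize_dotProduct_self hξ) (normalize_dotProduct_self hμ)
    (ne_of_gt (lt_of_lt_of_le neg_one_lt_zero ?_))
  rw [smul_dotProduct, dotProduct_smul]
  exact mul_nonneg (inv_nonneg.2 (enorm3_pos hξ).le)
    (mul_nonneg (inv_nonneg.2 (enorm3_pos hμ).le) hpos)
end
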